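/- arXiv:1510.05526 — 3 statements merged into one kernel-verified Lean document; each statement's English description precedes it below -/
import Mathlib

section
/- Let $\sigma, b : [0,1] \to \mathbb{R}$ be continuous with $\sigma^2(x) \ge d > 0$ for all $x$, let $\mu$ and $G$ be the associated invariant density and normalising constant, let $\mu_0$ be any probability density on $[0,1]$, and let $f : [0,1] \to \mathbb{R}$ be continuous. Define $Jf(x) = 2G \int_0^1 \left(\int_0^y \left(f(z) - \int_0^1 f\,d\mu\right)\mu(z)\,dz\right)\left(\mathbf{1}_{[0,x]}(y) - \int_y^1 \mu_0(s)\,ds\right)\exp\left(-\int_0^y \frac{2b(v)}{\sigma^2(v)}\,dv\right) dy$. Then $Jf$ is differentiable on $[0,1]$ with $\frac{d}{dx}(Jf)(x) = 2G\left(\int_0^x \left(f(z) - \int_0^1 f\,d\mu\right)\mu(z)\,dz\right)\exp\left(-\int_0^x \frac{2b(v)}{\sigma^2(v)}\,dv\right)$, and in particular $(Jf)'(0) = (Jf)'(1) = 0$. -/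
open MeasureTheory intervalIntegral Set

/-- The normalising constant `G` of the invariant density of the reflected diffusion with
drift `b` and squared diffusion coefficient `sq = σ²`. -/
noncomputable def normConst (b sq : ℝ → ℝ) : ℝ :=
  ∫ y in (0:ℝ)..1, (1 / sq y) * Real.exp (∫ z in (0:ℝ)..y, 2 * b z / sq z)

/-- The invariant density `μ` of the reflected diffusion. -/
noncomputable def invDens (b sq : ℝ → ℝ) (x : ℝ) : ℝ :=
  (1 / (normConst b sq * sq x)) * Real.exp (∫ y in (0:ℝ)..x, 2 * b y / sq y)

/-- The integral operator `J` with reference probability density `μ₀`: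
`Jf(x) = 2G ∫₀¹ (∫₀ʸ (f(z) - ∫f dμ) μ(z) dz) (1_{[0,x]}(y) - ∫_y¹ μ₀) exp(-∫₀ʸ 2b/σ²) dy`. -/
noncomputable def Jop (b sq μ₀ f : ℝ → ℝ) (x : ℝ) : ℝ :=
  2 * normConst b sq *
    ∫ y in (0:ℝ)..1,
      (∫ z in (0:ℝ)..y,
          (f z - ∫ w in (0:ℝ)..1, f w * invDens b sq w) * invDens b sq z) *
        ((Icc (0:ℝ) x).indicator (fun _ => (1:ℝ)) y - ∫ s in y..(1:ℝ), μ₀ s) *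
        Real.exp (-∫ v in (0:ℝ)..y, 2 * b v / sq v)

/-- The claimed derivative of `Jf`:
`(Jf)'(x) = 2G (∫₀ˣ (f(z) - ∫ f dμ) μ(z) dz) exp(-∫₀ˣ 2b/σ²)`. -/
noncomputable def JopDeriv (b sq f : ℝ → ℝ) (x : ℝ) : ℝ :=
  2 * normConst b sq *
    (∫ z in (0:ℝ)..x,
      (f z - ∫ w in (0:ℝ)..1, f w * invDens b sq w) * invDens b sq z) *
    Real.exp (-∫ v in (0:ℝ)..x, 2 * b v / sq v)

theorem continuousOn_primitive_Icc_zero_one {h : ℝ → ℝ} (hh : IntervalIntegrable h volume 0 1) :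
    ContinuousOn (fun x => ∫ t in (0:ℝ)..x, h t) (Icc 0 1) := by
  have h1 : IntegrableOn h (uIcc 0 1) := by
    rwa [uIcc_of_le zero_le_one, ← intervalIntegrable_iff_integrableOn_Icc_of_le zero_le_one]
  simpa [uIcc_of_le (zero_le_one (α := ℝ))] using continuousOn_primitive_interval h1

theorem ContinuousOn.intervalIntegrable_zero_one {h : ℝ → ℝ} (hh : ContinuousOn h (Icc 0 1)) :
    IntervalIntegrable h volume 0 1 :=
  hh.intervalIntegrable_of_Icc zero_le_one

theorem hasDerivWithinAt_primitive_Icc {h : ℝ → ℝ} (hh : ContinuousOn h (Icc 0 1))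
    {x : ℝ} (hx : x ∈ Icc (0:ℝ) 1) :
    HasDerivWithinAt (fun u => ∫ t in (0:ℝ)..u, h t) (h x) (Icc 0 1) x := by
  have : Fact (x ∈ Icc (0:ℝ) 1) := ⟨hx⟩
  exact integral_hasDerivWithinAt_right
    ((hh.mono (Icc_subset_Icc_right hx.2)).intervalIntegrable_of_Icc hx.1)
    (hh.stronglyMeasurableAtFilter_nhdsWithin measurableSet_Icc x) (hh x hx)

theorem integral_indicator_Icc_zero {h : ℝ → ℝ} {x : ℝ} (hx : x ∈ Icc (0:ℝ) 1) :
    ∫ y in (0:ℝ)..1, (Icc (0:ℝ) x).indicator h y = ∫ y in (0:ℝ)..x, h y := by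
  rw [integral_of_le zero_le_one, integral_of_le hx.1,
    setIntegral_indicator measurableSet_Icc]
  congr 2
  ext y
  simp only [mem_inter_iff, mem_Ioc, mem_Icc]
  exact ⟨fun h => ⟨h.1.1, h.2.2⟩, fun h => ⟨⟨h.1, h.2.trans hx.2⟩, h.1.le, h.2⟩⟩

theorem continuousOn_integral_drift {b sq : ℝ → ℝ} (hb : ContinuousOn b (Icc 0 1))
    (hs : ContinuousOn sq (Icc 0 1)) (hpos : ∀ x ∈ Icc (0:ℝ) 1, 0 < sq x) :
    ContinuousOn (fun x => ∫ y in (0:ℝ)..x, 2 * b y / sq y) (Icc 0 1) :=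
  continuousOn_primitive_Icc_zero_one (ContinuousOn.intervalIntegrable_zero_one
    ((continuousOn_const.mul hb).div hs fun x hx => (hpos x hx).ne'))

theorem normConst_pos {b sq : ℝ → ℝ} (hb : ContinuousOn b (Icc 0 1))
    (hs : ContinuousOn sq (Icc 0 1)) (hpos : ∀ x ∈ Icc (0:ℝ) 1, 0 < sq x) :
    0 < normConst b sq := by
  refine intervalIntegral_pos_of_pos_on (ContinuousOn.intervalIntegrable_zero_one
    ((continuousOn_const.div hs fun x hx => (hpos x hx).ne').mul
      (continuousOn_integral_drift hb hs hpos).rexp)) (fun x hx => ?_) zero_lt_one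
  have := hpos x (Ioo_subset_Icc_self hx)
  positivity

theorem continuousOn_invDens {b sq : ℝ → ℝ} (hb : ContinuousOn b (Icc 0 1))
    (hs : ContinuousOn sq (Icc 0 1)) (hpos : ∀ x ∈ Icc (0:ℝ) 1, 0 < sq x) :
    ContinuousOn (invDens b sq) (Icc 0 1) :=
  (continuousOn_const.div (continuousOn_const.mul hs) fun x hx =>
    mul_ne_zero (normConst_pos hb hs hpos).ne' (hpos x hx).ne').mul
      (continuousOn_integral_drift hb hs hpos).rexp

theorem integral_invDens {b sq : ℝ → ℝ} (hb : ContinuousOn b (Icc 0 1))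
    (hs : ContinuousOn sq (Icc 0 1)) (hpos : ∀ x ∈ Icc (0:ℝ) 1, 0 < sq x) :
    ∫ x in (0:ℝ)..1, invDens b sq x = 1 := by
  have h : invDens b sq = fun x => (normConst b sq)⁻¹ *
      ((1 / sq x) * Real.exp (∫ y in (0:ℝ)..x, 2 * b y / sq y)) := by
    ext x
    rw [invDens, one_div, mul_inv]
    ring
  rw [h, intervalIntegral.integral_const_mul]
  exact inv_mul_cancel₀ (normConst_pos hb hs hpos).ne'

theorem integral_centered_mul_invDens {b sq : ℝ → ℝ} (hb : ContinuousOn b (Icc 0 1))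
    (hs : ContinuousOn sq (Icc 0 1)) (hpos : ∀ x ∈ Icc (0:ℝ) 1, 0 < sq x)
    {f : ℝ → ℝ} (hf : ContinuousOn f (Icc 0 1)) :
    ∫ z in (0:ℝ)..1, (f z - ∫ w in (0:ℝ)..1, f w * invDens b sq w) * invDens b sq z = 0 := by
  have hμ := continuousOn_invDens hb hs hpos
  simp only [sub_mul]
  rw [intervalIntegral.integral_sub, intervalIntegral.integral_const_mul,
    integral_invDens hb hs hpos, mul_one, sub_self]
  · exact (hf.mul hμ).intervalIntegrable_zero_one
  · exact (continuousOn_const.mul hμ).intervalIntegrable_zero_one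

/-- `Jf` is differentiable on `[0,1]` with the stated derivative, which
vanishes at `0` and at `1`. -/
theorem stmt1 (d : ℝ) (hd : 0 < d) (σ b μ₀ f : ℝ → ℝ)
    (hσ : ContinuousOn σ (Icc 0 1)) (hb : ContinuousOn b (Icc 0 1))
    (hσd : ∀ x ∈ Icc (0:ℝ) 1, d ≤ σ x ^ 2)
    (hμ₀meas : Measurable μ₀) (hμ₀nonneg : ∀ x ∈ Icc (0:ℝ) 1, 0 ≤ μ₀ x)
    (hμ₀int : IntervalIntegrable μ₀ volume 0 1)
    (hμ₀one : (∫ x in (0:ℝ)..1, μ₀ x) = 1)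
    (hf : ContinuousOn f (Icc 0 1)) :
    (∀ x ∈ Icc (0:ℝ) 1,
      HasDerivWithinAt (Jop b (fun t => σ t ^ 2) μ₀ f)
        (JopDeriv b (fun t => σ t ^ 2) f x) (Icc 0 1) x) ∧
    JopDeriv b (fun t => σ t ^ 2) f 0 = 0 ∧ JopDeriv b (fun t => σ t ^ 2) f 1 = 0 := by
  set sq : ℝ → ℝ := fun t => σ t ^ 2
  have hs : ContinuousOn sq (Icc 0 1) := hσ.pow 2
  have hpos : ∀ x ∈ Icc (0:ℝ) 1, 0 < sq x := fun x hx => hd.trans_le (hσd x hx)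
  refine ⟨fun x hx => ?_, by simp [JopDeriv], by
    simp [JopDeriv, integral_centered_mul_invDens hb hs hpos hf]⟩
  have hμ := continuousOn_invDens hb hs hpos
  have hE := (continuousOn_integral_drift hb hs hpos).neg.rexp
  have hM := continuousOn_primitive_Icc_zero_one (ContinuousOn.intervalIntegrable_zero_one
    ((hf.sub (continuousOn_const (c := ∫ w in (0:ℝ)..1, f w * invDens b sq w))).mul hμ))
  have hK : ContinuousOn (fun y => ∫ s in y..(1:ℝ), μ₀ s) (Icc 0 1) := by
    refine ((continuousOn_const (c := ∫ s in (0:ℝ)..1, μ₀ s)).sub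
      (continuousOn_primitive_Icc_zero_one hμ₀int)).congr fun y hy => ?_
    exact (integral_interval_sub_left hμ₀int (hμ₀int.mono_set (by
      rw [uIcc_of_le hy.1, uIcc_of_le zero_le_one]; exact Icc_subset_Icc_right hy.2))).symm
  have hg := hM.mul hE
  have hgK := hg.mul hK
  have Jop_eq : ∀ u ∈ Icc (0:ℝ) 1, Jop b sq μ₀ f u = 2 * normConst b sq *
      ((∫ y in (0:ℝ)..u, (∫ z in (0:ℝ)..y,
          (f z - ∫ w in (0:ℝ)..1, f w * invDens b sq w) * invDens b sq z) *
        Real.exp (-∫ v in (0:ℝ)..y, 2 * b v / sq v)) -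
      ∫ y in (0:ℝ)..1, (∫ z in (0:ℝ)..y,
          (f z - ∫ w in (0:ℝ)..1, f w * invDens b sq w) * invDens b sq z) *
        Real.exp (-∫ v in (0:ℝ)..y, 2 * b v / sq v) * ∫ s in y..(1:ℝ), μ₀ s) := by
    intro u hu
    rw [← integral_indicator_Icc_zero hu, Jop, ← intervalIntegral.integral_sub]
    · congr 2
      ext y
      by_cases hy : y ∈ Icc 0 u
      · simp only [indicator_of_mem hy]
        ring
      · simp only [indicator_of_notMem hy]
        ring
    · rw [intervalIntegrable_iff_integrableOn_Icc_of_le zero_le_one]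
      exact (hg.integrableOn_Icc).indicator measurableSet_Icc
    · exact hgK.intervalIntegrable_zero_one
  have hder := ((hasDerivWithinAt_primitive_Icc hg hx).sub_const
    (∫ y in (0:ℝ)..1, (∫ z in (0:ℝ)..y,
          (f z - ∫ w in (0:ℝ)..1, f w * invDens b sq w) * invDens b sq z) *
        Real.exp (-∫ v in (0:ℝ)..y, 2 * b v / sq v) * ∫ s in y..(1:ℝ), μ₀ s)).const_mul
    (2 * normConst b sq)
  rw [JopDeriv, mul_assoc]
  exact hder.congr Jop_eq (Jop_eq x hx)
end

section
/- Let $\sigma, b : [0,1] \to \mathbb{R}$ be continuous with $\sigma^2(x) \ge d > 0$ for all $x$, let $\mu$ be the associated invariant density, and let $\mu_0$ be a probability density on $[0,1]$ with $\mu_0(x) > 0$ for all $x$. Suppose $f, f_1 : [0,1] \to \mathbb{R}$ are twice continuously differentiable with $f'(0) = f'(1) = f_1'(0) = f_1'(1) = 0$ and $\int_0^1 f\,d\mu_0 = \int_0^1 f_1\,d\mu_0$, and suppose there is a constant $c_0 \in \mathbb{R}$ such that $\frac{1}{2}\sigma^2(x)f''(x) + b(x)f'(x) = \frac{1}{2}\sigma^2(x)f_1''(x)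 + b(x)f_1'(x) + c_0$ for all $x \in [0,1]$. Then $c_0 = 0$ and $f = f_1$ on $[0,1]$. -/
open MeasureTheory intervalIntegral Set

theorem eq_left_of_hasDerivWithinAt_zero {g : ℝ → ℝ} {a b : ℝ}
    (hg : ∀ x ∈ Icc a b, HasDerivWithinAt g 0 (Icc a b) x) :
    ∀ x ∈ Icc a b, g x = g a := by
  refine constant_of_derivWithin_zero (fun x hx => (hg x hx).differentiableWithinAt) ?_
  intro x hx
  exact (hg x (Ico_subset_Icc_self hx)).derivWithin
    (uniqueDiffOn_Icc (hx.1.trans_lt hx.2) x (Ico_subset_Icc_self hx))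

/-- An antiderivative on `[a, b]` of a function continuous on `[a, b]`. -/
theorem exists_hasDerivWithinAt_of_continuousOn {p : ℝ → ℝ} {a b : ℝ} (hab : a ≤ b)
    (hp : ContinuousOn p (Icc a b)) :
    ∃ P : ℝ → ℝ, ∀ x ∈ Icc a b, HasDerivWithinAt P (p x) (Icc a b) x := by
  have hc : Continuous (IccExtend hab ((Icc a b).domRestrict p)) :=
    (continuousOn_iff_continuous_domRestrict.1 hp).Icc_extend'
  refine ⟨fun x => ∫ y in a..x, IccExtend hab ((Icc a b).domRestrict p) y, fun x hx => ?_⟩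
  have h := (hc.integral_hasStrictDerivAt a x).hasDerivAt.hasDerivWithinAt (s := Icc a b)
  rwa [IccExtend_of_mem hab _ hx] at h

/-- If `h' + p h = c q` on `[a, b]` with `q` nowhere zero and `h` vanishing at both end points,
then `c = 0` and `h = 0`. -/
theorem eq_zero_of_hasDerivWithinAt_add_mul {h p q : ℝ → ℝ} {a b c : ℝ} (hab : a < b)
    (hp : ContinuousOn p (Icc a b)) (hq : ∀ x ∈ Icc a b, q x ≠ 0)
    (hd : ∀ x ∈ Icc a b, HasDerivWithinAt h (c * q x - p x * h x) (Icc a b) x)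
    (ha : h a = 0) (hb : h b = 0) :
    c = 0 ∧ ∀ x ∈ Icc a b, h x = 0 := by
  obtain ⟨P, hP⟩ := exists_hasDerivWithinAt_of_continuousOn hab.le hp
  have hE : ∀ x ∈ Icc a b, HasDerivWithinAt (fun x => h x * Real.exp (P x))
      (c * q x * Real.exp (P x)) (Icc a b) x := fun x hx =>
    ((hd x hx).mul (hP x hx).exp).congr_deriv (by ring)
  have hc : c = 0 := by
    obtain ⟨x, hx, hx0⟩ := exists_hasDerivAt_eq_zero hab
      (fun x hx => (hE x hx).continuousWithinAt) (by simp [ha, hb])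
      (fun x hx => (hE x (Ioo_subset_Icc_self hx)).hasDerivAt (Icc_mem_nhds hx.1 hx.2))
    simpa [hq x (Ioo_subset_Icc_self hx)] using hx0
  refine ⟨hc, fun x hx => ?_⟩
  have hx0 := eq_left_of_hasDerivWithinAt_zero
    (fun y hy => (hE y hy).congr_deriv (by simp [hc])) x hx
  simpa [ha] using hx0

/-- injectivity of `L - μ₀(L)` on twice continuously differentiable functions
with Neumann boundary conditions and equal `μ₀`-means. -/
theorem stmt4 (d : ℝ) (hd : 0 < d) (σ b μ₀ : ℝ → ℝ)
    (hσ : ContinuousOn σ (Icc 0 1)) (hb : ContinuousOn b (Icc 0 1))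
    (hσd : ∀ x ∈ Icc (0:ℝ) 1, d ≤ σ x ^ 2)
    (hμ₀meas : Measurable μ₀) (hμ₀pos : ∀ x ∈ Icc (0:ℝ) 1, 0 < μ₀ x)
    (hμ₀int : IntervalIntegrable μ₀ volume 0 1)
    (hμ₀one : (∫ x in (0:ℝ)..1, μ₀ x) = 1)
    (f f₁ f' f₁' f'' f₁'' : ℝ → ℝ)
    (hfd : ∀ x ∈ Icc (0:ℝ) 1, HasDerivWithinAt f (f' x) (Icc 0 1) x)
    (hfd' : ∀ x ∈ Icc (0:ℝ) 1, HasDerivWithinAt f' (f'' x) (Icc 0 1) x)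
    (hf'' : ContinuousOn f'' (Icc 0 1))
    (hf₁d : ∀ x ∈ Icc (0:ℝ) 1, HasDerivWithinAt f₁ (f₁' x) (Icc 0 1) x)
    (hf₁d' : ∀ x ∈ Icc (0:ℝ) 1, HasDerivWithinAt f₁' (f₁'' x) (Icc 0 1) x)
    (hf₁'' : ContinuousOn f₁'' (Icc 0 1))
    (hN : f' 0 = 0 ∧ f' 1 = 0 ∧ f₁' 0 = 0 ∧ f₁' 1 = 0)
    (hmean : (∫ x in (0:ℝ)..1, f x * μ₀ x) = ∫ x in (0:ℝ)..1, f₁ x * μ₀ x)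
    (c₀ : ℝ)
    (heq : ∀ x ∈ Icc (0:ℝ) 1,
      (1 / 2) * σ x ^ 2 * f'' x + b x * f' x
        = (1 / 2) * σ x ^ 2 * f₁'' x + b x * f₁' x + c₀) :
    c₀ = 0 ∧ ∀ x ∈ Icc (0:ℝ) 1, f x = f₁ x := by
  obtain ⟨h0, h1, h₁0, h₁1⟩ := hN
  have hσ0 : ∀ x ∈ Icc (0:ℝ) 1, σ x ^ 2 ≠ 0 := fun x hx => (hd.trans_le (hσd x hx)).ne'
  obtain ⟨hc, hh⟩ := eq_zero_of_hasDerivWithinAt_add_mul (h := fun x => f' x - f₁' x)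
    (p := fun x => 2 * b x / σ x ^ 2) (q := fun x => 2 / σ x ^ 2) (c := c₀) zero_lt_one
    ((continuousOn_const.mul hb).div (hσ.pow 2) hσ0)
    (fun x hx => div_ne_zero two_ne_zero (hσ0 x hx))
    (fun x hx => ((hfd' x hx).sub (hf₁d' x hx)).congr_deriv (by
      have : σ x ≠ 0 := by simpa using hσ0 x hx
      field_simp
      linear_combination 2 * heq x hx))
    (by simp [h0, h₁0]) (by simp [h1, h₁1])
  refine ⟨hc, ?_⟩
  have hconst : ∀ x ∈ Icc (0:ℝ) 1, f x - f₁ x = f 0 - f₁ 0 :=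
    eq_left_of_hasDerivWithinAt_zero fun x hx =>
      ((hfd x hx).sub (hf₁d x hx)).congr_deriv (hh x hx)
  have hint : ∀ {g g' : ℝ → ℝ}, (∀ x ∈ Icc (0:ℝ) 1, HasDerivWithinAt g (g' x) (Icc 0 1) x) →
      IntervalIntegrable (fun x => g x * μ₀ x) volume 0 1 := fun hg =>
    hμ₀int.continuousOn_mul (by
      rw [uIcc_of_le zero_le_one]
      exact fun x hx => (hg x hx).continuousWithinAt)
  have hzero : f 0 - f₁ 0 = 0 := by
    calc f 0 - f₁ 0 = ∫ x in (0:ℝ)..1, (f 0 - f₁ 0) * μ₀ x := by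
          rw [intervalIntegral.integral_const_mul, hμ₀one, mul_one]
      _ = ∫ x in (0:ℝ)..1, (f x * μ₀ x - f₁ x * μ₀ x) := by
          refine intervalIntegral.integral_congr fun x hx => ?_
          rw [uIcc_of_le zero_le_one] at hx
          simp only [← hconst x hx, sub_mul]
      _ = 0 := by
          rw [intervalIntegral.integral_sub (hint hfd) (hint hf₁d), hmean, sub_self]
  exact fun x hx => sub_eq_zero.1 ((hconst x hx).trans hzero)
end

section
/- Let $N$ and $M$ be bounded self-adjoint operators on Hilbert spaces $H_1$ and $H_2$ respectively, and let $f$ be a continuous function defined on the union $\sigma(N) \cup \sigma(M)$ of their spectra satisfying $|f(z) - f(w)| \le \Lambda|z - w|$ for all $z, w \in \sigma(N) \cup \sigma(M)$ and some constant $\Lambda > 0$. Then for every bounded linear operator $X : H_2 \to H_1$ one has $\|f(N)X - Xf(M)\|_{HS} \le \Lambda\,\|NX - XM\|_{HS}$, where for an operator $A : H_2 \to H_1$ and an orthonormal basis $(\tilde e_l)_l$ of $H_2$ the Hilbert--Schmidt norm is $\|A\|_{HS}^2 = \sum_l \|A\tilde e_l\|_{H_1}^2$. -/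
open scoped ENNReal

/-- A Lipschitz function is uniformly approximated on a compact interval by polynomials which
are Lipschitz with almost the same constant. -/
lemma LipschitzWith.exists_polynomial_near {f : ℝ → ℝ} {K : NNReal} (hf : LipschitzWith K f)
    {r : ℝ} (hr : 0 ≤ r) {ε : ℝ} (hε : 0 < ε) :
    ∃ p : Polynomial ℝ, ∀ x ∈ Set.Icc (-r) r,
      |p.derivative.eval x| ≤ K + ε ∧ |p.eval x - f x| ≤ ε := by
  have hii : ∀ a b, IntervalIntegrable f MeasureTheory.volume a b :=
    fun a b => hf.continuous.intervalIntegrable a b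
  obtain ⟨h, hh, hKh⟩ : ∃ h : ℝ, 0 < h ∧ K * h ≤ ε / 2 := by
    refine ⟨ε / 2 / (K + 1), by positivity, ?_⟩
    rw [mul_div_assoc', div_le_iff₀ (by positivity)]
    nlinarith [K.2]
  set F : ℝ → ℝ := fun x => h⁻¹ * ∫ t in x..(x + h), f t with hF
  set F' : ℝ → ℝ := fun x => h⁻¹ * (f (x + h) - f x) with hF'
  have hder : ∀ x, HasDerivAt F (F' x) x := by
    intro x
    have hG : ∀ x, HasDerivAt (fun u => ∫ t in (0 : ℝ)..u, f t) (f x) x := fun x =>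
      intervalIntegral.integral_hasDerivAt_right (hii _ _)
        (hf.continuous.stronglyMeasurableAtFilter _ _) hf.continuous.continuousAt
    have : F = fun x => h⁻¹ * ((∫ t in (0 : ℝ)..(x + h), f t) - ∫ t in (0 : ℝ)..x, f t) := by
      ext x
      rw [intervalIntegral.integral_interval_sub_left (hii _ _) (hii _ _)]
    rw [this]
    exact (((hG (x + h)).comp_add_const x h).sub (hG x)).const_mul _
  have hF'K : ∀ x, |F' x| ≤ K := by
    intro x
    have := hf.dist_le_mul (x + h) x
    simp only [Real.dist_eq, add_sub_cancel_left, abs_of_pos hh] at this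
    rw [hF', abs_mul, abs_inv, abs_of_pos hh, inv_mul_le_iff₀ hh, mul_comm]
    exact this
  have hFf : ∀ x, |F x - f x| ≤ K * h := by
    intro x
    have h1 : F x - f x = h⁻¹ * ∫ t in x..(x + h), (f t - f x) := by
      rw [intervalIntegral.integral_sub (hii _ _) (by simp)]
      simp [hF, mul_sub, hh.ne']
    have h2 : ‖∫ t in x..(x + h), (f t - f x)‖ ≤ K * h * |x + h - x| := by
      refine intervalIntegral.norm_integral_le_of_norm_le_const fun t ht => ?_
      rw [Set.uIoc_of_le (by linarith)] at ht
      refine (hf.dist_le_mul t x).trans ?_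
      rw [Real.dist_eq, abs_of_pos (by linarith [ht.1])]
      gcongr
      linarith [ht.2]
    rw [h1, abs_mul, abs_inv, abs_of_pos hh, inv_mul_le_iff₀ hh, mul_comm]
    simpa [abs_of_pos hh] using h2
  obtain ⟨δ, hδ, hδε, hδr⟩ : ∃ δ : ℝ, 0 < δ ∧ δ ≤ ε ∧ δ * r ≤ ε / 2 := by
    refine ⟨min ε (ε / 2 / (r + 1)), by positivity, min_le_left _ _, ?_⟩
    calc min ε (ε / 2 / (r + 1)) * r ≤ ε / 2 / (r + 1) * (r + 1) := by
          gcongr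
          · exact min_le_right _ _
          · linarith
      _ = ε / 2 := by field_simp
  obtain ⟨q, hq⟩ := exists_polynomial_near_of_continuousOn (-r) r F'
    (by have := hf.continuous; fun_prop) δ hδ
  obtain ⟨p₀, hp₀⟩ : ∃ p₀ : Polynomial ℝ, p₀.derivative = q := by
    refine q.induction_on' ?_ ?_
    · rintro a b ⟨p, rfl⟩ ⟨p', rfl⟩
      exact ⟨p + p', by simp⟩
    · intro n a
      refine ⟨Polynomial.monomial (n + 1) (a / (n + 1)), ?_⟩
      rw [Polynomial.derivative_monomial]
      congr 1
      push_cast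
      field_simp
  set p := p₀ + Polynomial.C (F 0 - p₀.eval 0) with hp
  have hpq : p.derivative = q := by simp [hp, hp₀]
  refine ⟨p, fun x hx => ⟨?_, ?_⟩⟩
  · rw [hpq]
    have := abs_add_le (q.eval x - F' x) (F' x)
    rw [sub_add_cancel] at this
    linarith [hq x hx, hF'K x]
  · have h0 : (0 : ℝ) ∈ Set.Icc (-r) r := ⟨by linarith, hr⟩
    have hmv := (convex_Icc (-r) r).norm_image_sub_le_of_norm_hasDerivWithin_le
      (f := fun x => p.eval x - F x) (f' := fun x => q.eval x - F' x) (C := δ)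
      (fun x _ => by
        have := p.hasDerivAt x
        rw [hpq] at this
        exact (this.sub (hder x)).hasDerivWithinAt) (fun x hx => (hq x hx).le) h0 hx
    have hzero : p.eval 0 - F 0 = 0 := by simp [hp]
    rw [hzero, sub_zero, sub_zero, Real.norm_eq_abs, Real.norm_eq_abs] at hmv
    have hxr : δ * |x| ≤ δ * r := by
      gcongr
      exact abs_le.2 hx
    have := abs_add_le (p.eval x - F x) (F x - f x)
    rw [sub_add_sub_cancel] at this
    linarith [hFf x]

section

open Complex ComplexStarModule

/-- The divided difference `(p(a) - p(b)) / (a - b)` of a real polynomial `p`, evaluated at two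
elements of a complex algebra. -/
noncomputable def Polynomial.dividedDifference {A : Type*} [Ring A] [Algebra ℂ A]
    (p : Polynomial ℝ) (a b : A) : A :=
  ∑ n ∈ Finset.range (p.natDegree + 1),
    (p.coeff n : ℂ) • ∑ i ∈ Finset.range n, a ^ i * b ^ (n - 1 - i)

lemma Polynomial.norm_dividedDifference_ofReal_le {p : Polynomial ℝ} {C r : ℝ}
    (hp : ∀ x ∈ Set.Icc (-r) r, |p.derivative.eval x| ≤ C) {x y : ℝ}
    (hx : x ∈ Set.Icc (-r) r) (hy : y ∈ Set.Icc (-r) r) :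
    ‖p.dividedDifference (x : ℂ) (y : ℂ)‖ ≤ C := by
  have key : p.dividedDifference (x : ℂ) (y : ℂ) =
      ((∑ n ∈ Finset.range (p.natDegree + 1),
        p.coeff n * ∑ i ∈ Finset.range n, x ^ i * y ^ (n - 1 - i) : ℝ) : ℂ) := by
    simp [dividedDifference]
  rw [key, Complex.norm_real, Real.norm_eq_abs]
  rcases eq_or_ne x y with rfl | hxy
  · convert hp x hx using 2
    rw [Polynomial.derivative_eval, Polynomial.sum_over_range _ (by simp)]
    refine Finset.sum_congr rfl fun n _ => ?_
    rw [mul_assoc]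
    congr 1
    rw [Finset.sum_congr rfl (g := fun _ => x ^ (n - 1))]
    · simp
    · intro i hi
      rw [← pow_add]
      congr 1
      have := Finset.mem_range.1 hi
      omega
  · have h1 : (∑ n ∈ Finset.range (p.natDegree + 1),
        p.coeff n * ∑ i ∈ Finset.range n, x ^ i * y ^ (n - 1 - i)) * (x - y)
        = p.eval x - p.eval y := by
      rw [Polynomial.eval_eq_sum_range, Polynomial.eval_eq_sum_range, ← Finset.sum_sub_distrib,
        Finset.sum_mul]
      refine Finset.sum_congr rfl fun n _ => ?_
      rw [mul_assoc, geom_sum₂_mul, mul_sub]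
    have h2 := (convex_Icc (-r) r).norm_image_sub_le_of_norm_deriv_le (f := fun x => p.eval x)
      (C := C) (fun x _ => p.differentiableAt) (fun x hx => by simpa using hp x hx) hy hx
    rw [Real.norm_eq_abs, Real.norm_eq_abs, ← h1, abs_mul] at h2
    exact le_of_mul_le_mul_right h2 (abs_pos.2 (sub_ne_zero.2 hxy))

lemma Polynomial.norm_dividedDifference_le {A : Type*} [CStarAlgebra A] {p : Polynomial ℝ}
    {C r : ℝ} (hr : 0 ≤ r)
    (hp : ∀ x ∈ Set.Icc (-r) r, |p.derivative.eval x| ≤ C) {a b : A} (hab : Commute a b)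
    (ha : IsSelfAdjoint a) (hb : IsSelfAdjoint b) (har : ‖a‖ ≤ r) (hbr : ‖b‖ ≤ r) :
    ‖p.dividedDifference a b‖ ≤ C := by
  cases subsingleton_or_nontrivial A
  · have := (abs_nonneg _).trans (hp 0 ⟨by linarith, hr⟩)
    simpa [Subsingleton.elim (p.dividedDifference a b) 0] using this
  set c : A := a + I • b with hc
  have hstar : star c = a - I • b := by
    simp [hc, ha.star_eq, hb.star_eq, sub_eq_add_neg]
  have hcn : IsStarNormal c := by
    refine ⟨?_⟩
    rw [hstar]
    have := hab.eq
    simp only [Commute, SemiconjBy, hc, add_mul, mul_add, sub_mul, mul_sub, smul_mul_assoc,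
      mul_smul_comm, this]
    module
  have hrc : (ℜ c : A) = a := by
    rw [realPart_apply_coe, hstar, hc]
    module
  have hic : (ℑ c : A) = b := by
    rw [imaginaryPart_apply_coe, hstar, hc]
    have h2 : a + I • b - (a - I • b) = (2 : ℝ) • I • b := by rw [two_smul]; abel
    rw [h2, inv_smul_smul₀ two_ne_zero, smul_smul]
    simp
  have hre : cfc (fun z : ℂ => (z.re : ℂ)) c = a := by rw [cfc_re_id c, hrc]
  have him : cfc (fun z : ℂ => (z.im : ℂ)) c = b := by rw [cfc_im_id c, hic]
  have key : p.dividedDifference a b =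
      cfc (fun z : ℂ => p.dividedDifference (z.re : ℂ) (z.im : ℂ)) c := by
    unfold dividedDifference
    have hsum : (fun z : ℂ => ∑ n ∈ Finset.range (p.natDegree + 1),
        (p.coeff n : ℂ) • ∑ i ∈ Finset.range n, (z.re : ℂ) ^ i * (z.im : ℂ) ^ (n - 1 - i)) =
        ∑ n ∈ Finset.range (p.natDegree + 1), (p.coeff n : ℂ) •
          ∑ i ∈ Finset.range n, fun z : ℂ => (z.re : ℂ) ^ i * (z.im : ℂ) ^ (n - 1 - i) := by
      ext z
      simp
    have hcont : ∀ n : ℕ, Continuous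
        (∑ i ∈ Finset.range n, fun z : ℂ => (z.re : ℂ) ^ i * (z.im : ℂ) ^ (n - 1 - i)) :=
      fun n => by
        rw [show (∑ i ∈ Finset.range n, fun z : ℂ => (z.re : ℂ) ^ i * (z.im : ℂ) ^ (n - 1 - i)) =
          fun z : ℂ => ∑ i ∈ Finset.range n, (z.re : ℂ) ^ i * (z.im : ℂ) ^ (n - 1 - i) by
            ext z; simp]
        fun_prop
    rw [hsum, cfc_sum _ _ _ fun n _ => ((hcont n).const_smul _).continuousOn]
    refine Finset.sum_congr rfl fun n _ => ?_
    rw [show ∀ g : ℂ → ℂ, (p.coeff n : ℂ) • g = fun z => (p.coeff n : ℂ) • g z from fun _ => rfl,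
      cfc_smul _ _ _ (hcont n).continuousOn, cfc_sum _ _ _ fun i _ => by fun_prop]
    congr 1
    refine Finset.sum_congr rfl fun i _ => ?_
    have hre' : Continuous fun z : ℂ => (z.re : ℂ) := by fun_prop
    have him' : Continuous fun z : ℂ => (z.im : ℂ) := by fun_prop
    rw [cfc_mul (fun z : ℂ => (z.re : ℂ) ^ i) (fun z : ℂ => (z.im : ℂ) ^ (n - 1 - i)) c
        (hre'.pow _).continuousOn (him'.pow _).continuousOn,
      cfc_pow _ _ c hre'.continuousOn hcn, cfc_pow _ _ c him'.continuousOn hcn, hre, him]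
  rw [key]
  refine norm_cfc_le ((abs_nonneg _).trans (hp 0 ⟨by linarith, hr⟩)) fun z hz => ?_
  refine norm_dividedDifference_ofReal_le hp ?_ ?_
  · have : (z.re : ℂ) ∈ spectrum ℂ a := by
      rw [← hre, cfc_map_spectrum ..]
      exact ⟨z, hz, rfl⟩
    rw [Set.mem_Icc, ← abs_le]
    simpa using (spectrum.norm_le_norm_of_mem this).trans har
  · have : (z.im : ℂ) ∈ spectrum ℂ b := by
      rw [← him, cfc_map_spectrum ..]
      exact ⟨z, hz, rfl⟩
    rw [Set.mem_Icc, ← abs_le]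
    simpa using (spectrum.norm_le_norm_of_mem this).trans hbr

end

lemma memℓp_two_iff_tsum_enorm {ι E : Type*} [NormedAddCommGroup E] {g : ι → E} :
    Memℓp g 2 ↔ ∑' l, ‖g l‖ₑ ^ 2 ≠ ∞ := by
  rw [memℓp_gen_iff (by simp)]
  simp only [ENNReal.toReal_ofNat, Real.rpow_ofNat, enorm, ← ENNReal.coe_pow]
  rw [ENNReal.tsum_coe_ne_top_iff_summable, ← NNReal.summable_coe]
  simp

lemma lp.enorm_sq_eq_tsum {ι E : Type*} [NormedAddCommGroup E] (A : lp (fun _ : ι => E) 2) :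
    ‖A‖ₑ ^ 2 = ∑' l, ‖A l‖ₑ ^ 2 := by
  have h := lp.hasSum_norm (p := 2) (by simp) A
  simp only [ENNReal.toReal_ofNat, Real.rpow_ofNat] at h
  have h' := (ENNReal.ofReal_tsum_of_nonneg (fun _ => by positivity) h.summable)
  rw [h.tsum_eq] at h'
  simpa only [ENNReal.ofReal_pow (norm_nonneg _), ofReal_norm] using h'

section

variable {H₁ H₂ : Type*}
    [NormedAddCommGroup H₁] [InnerProductSpace ℂ H₁]
    [NormedAddCommGroup H₂] [InnerProductSpace ℂ H₂]

lemma HilbertBasis.tsum_enorm_inner_sq {ι : Type*} (e : HilbertBasis ι ℂ H₂) (x : H₂) :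
    ∑' i, ‖inner ℂ (e i) x‖ₑ ^ 2 = ‖x‖ₑ ^ 2 := by
  have h := lp.hasSum_norm (p := 2) (by simp) (e.repr x)
  simp only [ENNReal.toReal_ofNat, Real.rpow_ofNat, LinearIsometryEquiv.norm_map,
    HilbertBasis.repr_apply_apply] at h
  have h' := (ENNReal.ofReal_tsum_of_nonneg (fun _ => by positivity) h.summable).symm
  rw [h.tsum_eq] at h'
  simpa only [ENNReal.ofReal_pow (norm_nonneg _), ofReal_norm] using h'

lemma HilbertBasis.clm_ext {ι : Type*} (e : HilbertBasis ι ℂ H₂) {S T : H₂ →L[ℂ] H₁}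
    (h : ∀ l, S (e l) = T (e l)) : S = T := by
  refine ContinuousLinearMap.ext_on
    (Submodule.dense_iff_topologicalClosure_eq_top.2 e.dense_span) ?_
  rintro _ ⟨l, rfl⟩
  exact h l

lemma HilbertBasis.summable_repr_smul {ι : Type*} (e : HilbertBasis ι ℂ H₂)
    (A : lp (fun _ : ι => H₁) 2) (x : H₂) : Summable fun k => ‖e.repr x k • A k‖ := by
  have hpq : (2 : ℝ≥0∞).toReal.HolderConjugate (2 : ℝ≥0∞).toReal := by
    simpa using Real.HolderConjugate.two_two
  simpa [norm_smul] using lp.summable_mul hpq (lp.toNorm (e.repr x)) (lp.toNorm A)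

lemma ContinuousLinearMap.pow_comp_sub_comp_pow (N : H₁ →L[ℂ] H₁) (M : H₂ →L[ℂ] H₂)
    (X : H₂ →L[ℂ] H₁) (n : ℕ) :
    (N ^ n).comp X - X.comp (M ^ n) =
      ∑ i ∈ Finset.range n, (N ^ i).comp ((N.comp X - X.comp M).comp (M ^ (n - 1 - i))) := by
  induction n with
  | zero => ext; simp
  | succ n ih =>
    rw [Finset.sum_range_succ']
    have h : ∑ i ∈ Finset.range n, (N ^ (i + 1)).comp
        ((N.comp X - X.comp M).comp (M ^ (n + 1 - 1 - (i + 1)))) =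
        N.comp ((N ^ n).comp X - X.comp (M ^ n)) := by
      rw [ih]
      ext x
      simp only [sum_apply, ContinuousLinearMap.comp_apply, map_sum, pow_succ',
        mul_apply_eq_comp]
      refine Finset.sum_congr rfl fun i _ => ?_
      rw [show n + 1 - 1 - (i + 1) = n - 1 - i by omega]
    rw [h]
    ext x
    simp [pow_succ']

variable [CompleteSpace H₁]

/-- The Hilbert-Schmidt operator with prescribed square-summable values on a Hilbert basis. -/
noncomputable def HilbertBasis.toCLM {ι : Type*} (e : HilbertBasis ι ℂ H₂)
    (A : lp (fun _ : ι => H₁) 2) : H₂ →L[ℂ] H₁ :=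
  LinearMap.mkContinuous
    { toFun := fun x => ∑' k, e.repr x k • A k
      map_add' := fun x y => by
        rw [← (e.summable_repr_smul A x).of_norm.tsum_add (e.summable_repr_smul A y).of_norm]
        simp [add_smul]
      map_smul' := fun c x => by
        rw [RingHom.id_apply, ← (e.summable_repr_smul A x).of_norm.tsum_const_smul]
        simp [mul_smul] } ‖A‖ fun x => by
    have hpq : (2 : ℝ≥0∞).toReal.HolderConjugate (2 : ℝ≥0∞).toReal := by
      simpa using Real.HolderConjugate.two_two
    have h := lp.tsum_mul_le_mul_norm' hpq (lp.toNorm (e.repr x)) (lp.toNorm A)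
    rw [lp.norm_toNorm, lp.norm_toNorm, LinearIsometryEquiv.norm_map, mul_comm] at h
    refine le_trans (norm_tsum_le_tsum_norm (e.summable_repr_smul A x)) ?_
    simpa [norm_smul] using h

lemma HilbertBasis.toCLM_apply {ι : Type*} (e : HilbertBasis ι ℂ H₂)
    (A : lp (fun _ : ι => H₁) 2) (x : H₂) : e.toCLM A x = ∑' k, e.repr x k • A k := rfl

@[simp]
lemma HilbertBasis.toCLM_apply_basis {ι : Type*} (e : HilbertBasis ι ℂ H₂)
    (A : lp (fun _ : ι => H₁) 2) (l : ι) : e.toCLM A (e l) = A l := by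
  classical
  rw [toCLM_apply, e.repr_self, tsum_eq_single l]
  · simp
  · intro k hk
    rw [lp.single_apply_ne _ _ _ hk, zero_smul]

lemma HilbertBasis.toCLM_single {ι : Type*} [DecidableEq ι] (e : HilbertBasis ι ℂ H₂)
    (j : ι) (a : H₁) (x : H₂) :
    e.toCLM (lp.single 2 j a) x = (inner ℂ (e j) x : ℂ) • a := by
  rw [toCLM_apply, tsum_eq_single j]
  · simp [HilbertBasis.repr_apply_apply]
  · intro k hk
    rw [lp.single_apply_ne _ _ _ hk, smul_zero]

/-- `HilbertBasis.toCLM` as a linear map. -/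
noncomputable def HilbertBasis.toCLMₗ {ι : Type*} (e : HilbertBasis ι ℂ H₂) :
    lp (fun _ : ι => H₁) 2 →ₗ[ℂ] H₂ →L[ℂ] H₁ where
  toFun := e.toCLM
  map_add' A B := e.clm_ext fun l => by simp
  map_smul' c A := e.clm_ext fun l => by simp

variable [CompleteSpace H₂]

lemma HilbertBasis.tsum_enorm_sq_adjoint {ι κ : Type*} (e : HilbertBasis ι ℂ H₂)
    (b : HilbertBasis κ ℂ H₁) (T : H₂ →L[ℂ] H₁) :
    ∑' l, ‖T (e l)‖ₑ ^ 2 = ∑' j, ‖T.adjoint (b j)‖ₑ ^ 2 := by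
  simp_rw [← b.tsum_enorm_inner_sq (T (e _)), ← e.tsum_enorm_inner_sq (T.adjoint (b _)),
    ContinuousLinearMap.adjoint_inner_right]
  rw [ENNReal.tsum_comm]
  simp_rw [← ofReal_norm, norm_inner_symm]

/-- The Hilbert-Schmidt norm of a product is at most the operator norm of the right factor times
the Hilbert-Schmidt norm of the left factor. -/
lemma HilbertBasis.tsum_enorm_sq_comp_le {ι : Type*} (e : HilbertBasis ι ℂ H₂)
    (T : H₂ →L[ℂ] H₁) (M : H₂ →L[ℂ] H₂) :
    ∑' l, ‖T (M (e l))‖ₑ ^ 2 ≤ ‖M‖ₑ ^ 2 * ∑' l, ‖T (e l)‖ₑ ^ 2 := by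
  obtain ⟨w, b, -⟩ := exists_hilbertBasis ℂ H₁
  have h := e.tsum_enorm_sq_adjoint b (T.comp M)
  simp only [ContinuousLinearMap.comp_apply, ContinuousLinearMap.adjoint_comp] at h
  rw [h, e.tsum_enorm_sq_adjoint b T, ← ENNReal.tsum_mul_left]
  refine ENNReal.tsum_le_tsum fun j => ?_
  rw [← mul_pow]
  gcongr
  have := M.adjoint.le_opENorm (T.adjoint (b j))
  rwa [← ofReal_norm M.adjoint, LinearIsometryEquiv.norm_map, ofReal_norm] at this

lemma HilbertBasis.tsum_enorm_sq_sandwich_le {ι : Type*} (e : HilbertBasis ι ℂ H₂)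
    (N : H₁ →L[ℂ] H₁) (M : H₂ →L[ℂ] H₂) (A : lp (fun _ : ι => H₁) 2) :
    ∑' l, ‖N (e.toCLM A (M (e l)))‖ₑ ^ 2 ≤ (‖N‖ₑ * ‖M‖ₑ * ‖A‖ₑ) ^ 2 := calc
  _ ≤ ∑' l, ‖N‖ₑ ^ 2 * ‖e.toCLM A (M (e l))‖ₑ ^ 2 := by
    refine ENNReal.tsum_le_tsum fun l => ?_
    rw [← mul_pow]
    gcongr
    exact N.le_opENorm _
  _ ≤ ‖N‖ₑ ^ 2 * (‖M‖ₑ ^ 2 * ∑' l, ‖e.toCLM A (e l)‖ₑ ^ 2) := by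
    rw [ENNReal.tsum_mul_left]
    gcongr
    exact e.tsum_enorm_sq_comp_le _ _
  _ = (‖N‖ₑ * ‖M‖ₑ * ‖A‖ₑ) ^ 2 := by
    simp_rw [toCLM_apply_basis, ← lp.enorm_sq_eq_tsum, mul_pow, mul_assoc]

/-- The map `A ↦ N A M` on Hilbert-Schmidt operators, each represented by the square-summable
family of its values on a Hilbert basis, as a linear map. -/
noncomputable def HilbertBasis.sandwichₗ {ι : Type*} (e : HilbertBasis ι ℂ H₂)
    (N : H₁ →L[ℂ] H₁) (M : H₂ →L[ℂ] H₂) :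
    lp (fun _ : ι => H₁) 2 →ₗ[ℂ] lp (fun _ : ι => H₁) 2 where
  toFun A := ⟨fun l => N (e.toCLM A (M (e l))), memℓp_two_iff_tsum_enorm.2
    ((e.tsum_enorm_sq_sandwich_le N M A).trans_lt (by finiteness)).ne⟩
  map_add' A B := by
    ext l
    simp only [show e.toCLM (A + B) = _ from map_add e.toCLMₗ A B]
    exact map_add N _ _
  map_smul' c A := by
    ext l
    simp only [show e.toCLM (c • A) = _ from map_smul e.toCLMₗ c A]
    exact map_smul N _ _

lemma HilbertBasis.norm_sandwichₗ_le {ι : Type*} (e : HilbertBasis ι ℂ H₂)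
    (N : H₁ →L[ℂ] H₁) (M : H₂ →L[ℂ] H₂) (A : lp (fun _ : ι => H₁) 2) :
    ‖e.sandwichₗ N M A‖ ≤ ‖N‖ * ‖M‖ * ‖A‖ := by
  have h := e.tsum_enorm_sq_sandwich_le N M A
  rw [show ∑' l, ‖N (e.toCLM A (M (e l)))‖ₑ ^ 2 = ‖e.sandwichₗ N M A‖ₑ ^ 2 from
    (lp.enorm_sq_eq_tsum (e.sandwichₗ N M A)).symm, ENNReal.pow_le_pow_left_iff two_ne_zero] at h
  simpa using ENNReal.toReal_mono (by finiteness) h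

/-- The map `A ↦ N A M` on Hilbert-Schmidt operators, each represented by the square-summable
family of its values on a Hilbert basis. -/
noncomputable def HilbertBasis.sandwich {ι : Type*} (e : HilbertBasis ι ℂ H₂)
    (N : H₁ →L[ℂ] H₁) (M : H₂ →L[ℂ] H₂) :
    lp (fun _ : ι => H₁) 2 →L[ℂ] lp (fun _ : ι => H₁) 2 :=
  (e.sandwichₗ N M).mkContinuous (‖N‖ * ‖M‖) (e.norm_sandwichₗ_le N M)

lemma HilbertBasis.sandwich_apply {ι : Type*} (e : HilbertBasis ι ℂ H₂)
    (N : H₁ →L[ℂ] H₁) (M : H₂ →L[ℂ] H₂) (A : lp (fun _ : ι => H₁) 2) (l : ι) :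
    e.sandwich N M A l = N (e.toCLM A (M (e l))) := rfl

lemma HilbertBasis.norm_sandwich_le {ι : Type*} (e : HilbertBasis ι ℂ H₂)
    (N : H₁ →L[ℂ] H₁) (M : H₂ →L[ℂ] H₂) : ‖e.sandwich N M‖ ≤ ‖N‖ * ‖M‖ :=
  LinearMap.mkContinuous_norm_le _ (by positivity) (e.norm_sandwichₗ_le N M)

lemma HilbertBasis.toCLM_sandwich {ι : Type*} (e : HilbertBasis ι ℂ H₂)
    (N : H₁ →L[ℂ] H₁) (M : H₂ →L[ℂ] H₂) (A : lp (fun _ : ι => H₁) 2) :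
    e.toCLM (e.sandwich N M A) = N.comp ((e.toCLM A).comp M) :=
  e.clm_ext fun l => by simp [sandwich_apply]

lemma HilbertBasis.sandwich_mul {ι : Type*} (e : HilbertBasis ι ℂ H₂)
    (N N' : H₁ →L[ℂ] H₁) (M M' : H₂ →L[ℂ] H₂) :
    e.sandwich N M * e.sandwich N' M' = e.sandwich (N * N') (M' * M) := by
  ext A l
  simp [sandwich_apply, toCLM_sandwich]

lemma HilbertBasis.sandwich_one {ι : Type*} (e : HilbertBasis ι ℂ H₂) :
    e.sandwich (1 : H₁ →L[ℂ] H₁) 1 = 1 := by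
  ext A l
  simp [sandwich_apply]

lemma HilbertBasis.sandwich_pow {ι : Type*} (e : HilbertBasis ι ℂ H₂)
    (N : H₁ →L[ℂ] H₁) (M : H₂ →L[ℂ] H₂) (n : ℕ) :
    e.sandwich N M ^ n = e.sandwich (N ^ n) (M ^ n) := by
  induction n with
  | zero => simp [sandwich_one]
  | succ n ih => rw [pow_succ, ih, sandwich_mul, pow_succ, ← pow_succ']

lemma HilbertBasis.isSelfAdjoint_sandwich {ι : Type*} (e : HilbertBasis ι ℂ H₂)
    {N : H₁ →L[ℂ] H₁} {M : H₂ →L[ℂ] H₂} (hN : IsSelfAdjoint N) (hM : IsSelfAdjoint M) :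
    IsSelfAdjoint (e.sandwich N M) := by
  classical
  rw [ContinuousLinearMap.isSelfAdjoint_iff']
  refine lp.ext_continuousLinearMap (by simp) fun i => ?_
  ext a j
  refine ext_inner_left ℂ fun b => ?_
  have h (v : lp (fun _ : ι => H₁) 2) : inner ℂ b (v j) = inner ℂ (lp.single 2 j b) v :=
    (lp.inner_single_left j b v).symm
  rw [h, h]
  simp only [ContinuousLinearMap.comp_apply, ContinuousLinearMap.adjoint_inner_right,
    lp.singleContinuousLinearMap_apply, lp.inner_single_left, lp.inner_single_right,
    sandwich_apply, toCLM_single, map_smul, inner_smul_left, inner_smul_right, inner_conj_symm]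
  rw [← ContinuousLinearMap.adjoint_inner_left, ← ContinuousLinearMap.adjoint_inner_left,
    hN.adjoint_eq, hM.adjoint_eq]

lemma HilbertBasis.toCLM_dividedDifference_apply {ι : Type*} (e : HilbertBasis ι ℂ H₂)
    (N : H₁ →L[ℂ] H₁) (M : H₂ →L[ℂ] H₂) (X : H₂ →L[ℂ] H₁) {d : lp (fun _ : ι => H₁) 2}
    (hd : e.toCLM d = N.comp X - X.comp M) (p : Polynomial ℝ) :
    e.toCLM (p.dividedDifference (e.sandwich N 1) (e.sandwich 1 M) d) =
      (Polynomial.aeval N p).comp X - X.comp (Polynomial.aeval M p) := by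
  have hterm (i j : ℕ) : e.toCLMₗ ((e.sandwich N 1 ^ i * e.sandwich 1 M ^ j :
      lp (fun _ : ι => H₁) 2 →L[ℂ] lp (fun _ : ι => H₁) 2) d) =
      (N ^ i).comp ((N.comp X - X.comp M).comp (M ^ j)) := by
    rw [sandwich_pow, sandwich_pow, sandwich_mul, one_pow, one_pow, mul_one, mul_one, ← hd]
    exact e.toCLM_sandwich _ _ _
  change e.toCLMₗ _ = _
  simp only [Polynomial.dividedDifference, sum_apply, smul_apply, map_sum, map_smul, hterm,
    ← ContinuousLinearMap.pow_comp_sub_comp_pow]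
  ext x
  simp only [Polynomial.aeval_eq_sum_range, sum_apply, smul_apply, sub_apply,
    ContinuousLinearMap.comp_apply, map_sum, ← Finset.sum_sub_distrib]
  refine Finset.sum_congr rfl fun n _ => ?_
  rw [smul_sub, ← Complex.coe_smul, ← Complex.coe_smul, map_smul]

/-- The Hilbert-Schmidt bound for polynomials, in terms of a bound for the derivative. -/
lemma HilbertBasis.sum_norm_sq_aeval_le {ι : Type*} (e : HilbertBasis ι ℂ H₂)
    {N : H₁ →L[ℂ] H₁} {M : H₂ →L[ℂ] H₂} (hN : IsSelfAdjoint N) (hM : IsSelfAdjoint M)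
    (X : H₂ →L[ℂ] H₁) {d : lp (fun _ : ι => H₁) 2}
    (hd : e.toCLM d = N.comp X - X.comp M) {p : Polynomial ℝ} {C r : ℝ}
    (hNr : ‖N‖ ≤ r) (hMr : ‖M‖ ≤ r)
    (hp : ∀ x ∈ Set.Icc (-r) r, |p.derivative.eval x| ≤ C) (s : Finset ι) :
    ∑ l ∈ s, ‖((Polynomial.aeval N p).comp X - X.comp (Polynomial.aeval M p)) (e l)‖ ^ 2 ≤
      (C * ‖d‖) ^ 2 := by
  rw [← e.toCLM_dividedDifference_apply N M X hd p]
  simp only [toCLM_apply_basis]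
  have hr : 0 ≤ r := (norm_nonneg N).trans hNr
  have hop : ‖p.dividedDifference (e.sandwich N 1) (e.sandwich 1 M)‖ ≤ C := by
    refine Polynomial.norm_dividedDifference_le hr hp ?_
      (e.isSelfAdjoint_sandwich hN (.one _)) (e.isSelfAdjoint_sandwich (.one _) hM) ?_ ?_
    · rw [Commute, SemiconjBy, sandwich_mul, sandwich_mul]
      simp
    · refine (e.norm_sandwich_le _ _).trans ?_
      have := mul_le_mul_of_nonneg_left (ContinuousLinearMap.norm_id_le (𝕜 := ℂ) (E := H₂))
        (norm_nonneg N)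
      rw [mul_one] at this
      exact this.trans hNr
    · refine (e.norm_sandwich_le _ _).trans ?_
      have := mul_le_mul_of_nonneg_right (ContinuousLinearMap.norm_id_le (𝕜 := ℂ) (E := H₁))
        (norm_nonneg M)
      rw [one_mul] at this
      exact this.trans hMr
  have h := lp.sum_rpow_le_norm_rpow (p := 2) (by simp)
    (p.dividedDifference (e.sandwich N 1) (e.sandwich 1 M) d) s
  simp only [ENNReal.toReal_ofNat, Real.rpow_ofNat] at h
  refine h.trans ?_
  gcongr
  exact ContinuousLinearMap.le_of_opNorm_le _ hop d

lemma ContinuousLinearMap.mem_Icc_of_mem_spectrum {N : H₁ →L[ℂ] H₁} {x r : ℝ}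
    (hNr : ‖N‖ ≤ r) (hx : x ∈ spectrum ℝ N) : x ∈ Set.Icc (-r) r := by
  have h1 := spectrum.norm_le_norm_mul_of_mem hx
  have h2 := mul_le_mul_of_nonneg_left (ContinuousLinearMap.norm_id_le (𝕜 := ℂ) (E := H₁))
    (norm_nonneg N)
  rw [mul_one] at h2
  exact abs_le.1 (h1.trans (h2.trans hNr))

lemma norm_aeval_sub_cfc_le {A : Type*} [CStarAlgebra A] {a : A} (ha : IsSelfAdjoint a)
    {f : ℝ → ℝ} (hf : ContinuousOn f (spectrum ℝ a)) {p : Polynomial ℝ} {ε : ℝ} (hε : 0 ≤ ε)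
    (h : ∀ x ∈ spectrum ℝ a, |p.eval x - f x| ≤ ε) :
    ‖Polynomial.aeval a p - cfc f a‖ ≤ ε := by
  rw [← cfc_polynomial p a ha, ← cfc_sub _ _ a p.continuous.continuousOn hf]
  exact norm_cfc_le hε h

/-- The Hilbert-Schmidt bound for Lipschitz functions, for finite partial sums. -/
lemma HilbertBasis.sum_norm_sq_cfc_le {ι : Type*} (e : HilbertBasis ι ℂ H₂)
    {N : H₁ →L[ℂ] H₁} {M : H₂ →L[ℂ] H₂} (hN : IsSelfAdjoint N) (hM : IsSelfAdjoint M)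
    (X : H₂ →L[ℂ] H₁) {d : lp (fun _ : ι => H₁) 2}
    (hd : e.toCLM d = N.comp X - X.comp M) {f : ℝ → ℝ} {K : NNReal}
    (hf : LipschitzOnWith K f (spectrum ℝ N ∪ spectrum ℝ M)) (s : Finset ι) :
    ∑ l ∈ s, ‖((cfc f N).comp X - X.comp (cfc f M)) (e l)‖ ^ 2 ≤ (K * ‖d‖) ^ 2 := by
  obtain ⟨g, hg, hfg⟩ := hf.extend_real
  rw [cfc_congr (hfg.mono Set.subset_union_left), cfc_congr (hfg.mono Set.subset_union_right)]
  set r := max ‖N‖ ‖M‖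
  have hr : 0 ≤ r := (norm_nonneg N).trans (le_max_left _ _)
  obtain ⟨u, -, hu0, hu⟩ := exists_seq_strictAnti_tendsto (0 : ℝ)
  choose p hp using fun n => hg.exists_polynomial_near hr (hu0 n)
  have hpN : Filter.Tendsto (fun n => Polynomial.aeval N (p n)) Filter.atTop (nhds (cfc g N)) :=
    tendsto_iff_norm_sub_tendsto_zero.2 <| squeeze_zero (fun _ => norm_nonneg _)
      (fun n => norm_aeval_sub_cfc_le hN hg.continuous.continuousOn (hu0 n).le fun x hx =>
        (hp n x (ContinuousLinearMap.mem_Icc_of_mem_spectrum (le_max_left _ _) hx)).2) hu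
  have hpM : Filter.Tendsto (fun n => Polynomial.aeval M (p n)) Filter.atTop (nhds (cfc g M)) :=
    tendsto_iff_norm_sub_tendsto_zero.2 <| squeeze_zero (fun _ => norm_nonneg _)
      (fun n => norm_aeval_sub_cfc_le hM hg.continuous.continuousOn (hu0 n).le fun x hx =>
        (hp n x (ContinuousLinearMap.mem_Icc_of_mem_spectrum (le_max_right _ _) hx)).2) hu
  have hlim (l : ι) : Filter.Tendsto (fun n => ((Polynomial.aeval N (p n)).comp X -
      X.comp (Polynomial.aeval M (p n))) (e l)) Filter.atTop
      (nhds (((cfc g N).comp X - X.comp (cfc g M)) (e l))) := by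
    simp only [sub_apply, ContinuousLinearMap.comp_apply]
    exact ((ContinuousLinearMap.apply ℂ H₁ (X (e l))).continuous.tendsto _ |>.comp hpN).sub
      ((X.continuous.tendsto _).comp
        ((ContinuousLinearMap.apply ℂ H₂ (e l)).continuous.tendsto _ |>.comp hpM))
  have hrhs : Filter.Tendsto (fun n => ((K + u n) * ‖d‖) ^ 2) Filter.atTop
      (nhds ((K * ‖d‖) ^ 2)) := by
    simpa using ((hu.const_add (K : ℝ)).mul_const ‖d‖).pow 2
  exact le_of_tendsto_of_tendsto' (tendsto_finsetSum s fun l _ => (hlim l).norm.pow 2) hrhs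
    fun n => e.sum_norm_sq_aeval_le hN hM X hd (le_max_left _ _) (le_max_right _ _)
      (fun x hx => (hp n x hx).1) s

end

/-- Lipschitz functional calculus bound in Hilbert--Schmidt norm:
`‖f(N)X - Xf(M)‖_HS ≤ Λ ‖NX - XM‖_HS` for self-adjoint `N`, `M` and `f` Lipschitz with
constant `Λ` on `σ(N) ∪ σ(M)`; the Hilbert--Schmidt norms are computed as
`‖A‖_HS² = ∑ₗ ‖A ẽₗ‖²` over an orthonormal basis `(ẽₗ)` of `H₂`, with value `+∞` allowed. -/
theorem stmt7 {H₁ H₂ : Type*}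
    [NormedAddCommGroup H₁] [InnerProductSpace ℂ H₁] [CompleteSpace H₁]
    [NormedAddCommGroup H₂] [InnerProductSpace ℂ H₂] [CompleteSpace H₂]
    (N : H₁ →L[ℂ] H₁) (M : H₂ →L[ℂ] H₂)
    (hN : IsSelfAdjoint N) (hM : IsSelfAdjoint M)
    (f : ℝ → ℝ) (hf : ContinuousOn f (spectrum ℝ N ∪ spectrum ℝ M))
    (Λ : ℝ) (hΛ : 0 < Λ)
    (hLip : ∀ z ∈ spectrum ℝ N ∪ spectrum ℝ M, ∀ w ∈ spectrum ℝ N ∪ spectrum ℝ M,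
      |f z - f w| ≤ Λ * |z - w|)
    (X : H₂ →L[ℂ] H₁) {ι : Type*} (e : HilbertBasis ι ℂ H₂) :
    (∑' l, ((‖((cfc f N).comp X - X.comp (cfc f M)) (e l)‖₊ : ℝ≥0∞) ^ 2)) ^ (1/2 : ℝ)
      ≤ ENNReal.ofReal Λ *
        (∑' l, ((‖(N.comp X - X.comp M) (e l)‖₊ : ℝ≥0∞) ^ 2)) ^ (1/2 : ℝ) := by
  simp only [← enorm_eq_nnnorm]
  by_cases hfin : ∑' l, ‖(N.comp X - X.comp M) (e l)‖ₑ ^ 2 = ∞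
  · rw [hfin, ENNReal.top_rpow_of_pos (by norm_num),
      ENNReal.mul_top (ENNReal.ofReal_pos.2 hΛ).ne']
    exact le_top
  let d : lp (fun _ : ι => H₁) 2 := ⟨_, memℓp_two_iff_tsum_enorm.2 hfin⟩
  have hd : e.toCLM d = N.comp X - X.comp M := e.clm_ext fun l => e.toCLM_apply_basis d l
  have hK : LipschitzOnWith Λ.toNNReal f (spectrum ℝ N ∪ spectrum ℝ M) :=
    LipschitzOnWith.of_dist_le_mul fun z hz w hw => by
      simpa [Real.dist_eq, hΛ.le] using hLip z hz w hw
  have hsum : ∑' l, ‖((cfc f N).comp X - X.comp (cfc f M)) (e l)‖ₑ ^ 2 ≤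
      (ENNReal.ofReal Λ * ‖d‖ₑ) ^ 2 := by
    refine ENNReal.summable.tsum_le_of_sum_le fun s => ?_
    have h := ENNReal.ofReal_le_ofReal (e.sum_norm_sq_cfc_le hN hM X hd hK s)
    rw [ENNReal.ofReal_sum_of_nonneg fun _ _ => by positivity] at h
    rw [ENNReal.ofReal_pow (by positivity), ENNReal.ofReal_mul (NNReal.coe_nonneg _)] at h
    simpa using h
  have hsqrt (x : ℝ≥0∞) : (x ^ 2) ^ (1 / 2 : ℝ) = x := by
    rw [← ENNReal.rpow_natCast_mul]
    norm_num
  rw [show ∑' l, ‖(N.comp X - X.comp M) (e l)‖ₑ ^ 2 = ‖d‖ₑ ^ 2 from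
    (lp.enorm_sq_eq_tsum d).symm, hsqrt]
  exact (ENNReal.rpow_le_rpow hsum (by norm_num)).trans_eq (hsqrt _)
end
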